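/- arXiv:1310.0995 — 5 statements merged into one kernel-verified Lean document; each statement's English description precedes it below -/
import Mathlib

section
/- Let (X, d) be a complete metric space and let T : X → X. Suppose there exist an altering distance function ψ and a constant c ∈ [0,1) such that ψ(d(Tx, Ty)) ≤ c·ψ(d(x, y)) for all x, y ∈ X. Then T has a unique fixed point. -/
section AlteringDistance

variable {X : Type*} {T : X → X} {ψ : ℝ → ℝ} {c : ℝ}

theorem lt_of_altering_lt (hψ_mono : MonotoneOn ψ (Set.Ici 0)) {s t : ℝ} (hs : 0 ≤ s)
    (ht : 0 ≤ t) (h : ψ s < ψ t) : s < t :=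
  hψ_mono.reflect_lt hs ht h

theorem altering_pos (hψ_nonneg : ∀ t, 0 ≤ t → 0 ≤ ψ t)
    (hψ_zero : ∀ t, 0 ≤ t → (ψ t = 0 ↔ t = 0)) {t : ℝ} (ht : 0 < t) : 0 < ψ t :=
  (hψ_nonneg t ht.le).lt_of_ne fun h => ht.ne' ((hψ_zero t ht.le).1 h.symm)

theorem exists_mul_altering_add_lt (hψ_cont : ContinuousOn ψ (Set.Ici 0)) (hc1 : c < 1)
    {ε : ℝ} (hε : 0 < ε) (hpos : 0 < ψ ε) :
    ∃ δ > 0, δ ≤ ε ∧ c * ψ (ε + δ) < ψ ε := by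
  have hcont : ContinuousAt (fun t => c * ψ t) ε :=
    (hψ_cont.continuousAt (Ici_mem_nhds hε)).const_mul c
  have hlt : c * ψ ε < ψ ε := by nlinarith
  obtain ⟨η, hη, h⟩ := Metric.eventually_nhds_iff.1 (hcont.eventually_lt_const hlt)
  refine ⟨min (η / 2) ε, by positivity, min_le_right _ _, h ?_⟩
  have hmin : 0 < min (η / 2) ε := by positivity
  rw [Real.dist_eq, add_sub_cancel_left, abs_of_pos hmin]
  linarith [min_le_left (η / 2) ε]

variable [MetricSpace X]

theorem dist_map_le_of_altering (hψ_nonneg : ∀ t, 0 ≤ t → 0 ≤ ψ t)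
    (hψ_zero : ∀ t, 0 ≤ t → (ψ t = 0 ↔ t = 0)) (hψ_mono : MonotoneOn ψ (Set.Ici 0))
    (hc1 : c < 1) (hT : ∀ x y : X, ψ (dist (T x) (T y)) ≤ c * ψ (dist x y)) (x y : X) :
    dist (T x) (T y) ≤ dist x y := by
  rcases eq_or_ne x y with rfl | hxy
  · simp
  · have hpos := altering_pos hψ_nonneg hψ_zero (dist_pos.2 hxy)
    exact (lt_of_altering_lt hψ_mono dist_nonneg dist_nonneg
      ((hT x y).trans_lt (by nlinarith))).le

theorem altering_dist_iterate_le (hc0 : 0 ≤ c)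
    (hT : ∀ x y : X, ψ (dist (T x) (T y)) ≤ c * ψ (dist x y)) (x y : X) (n : ℕ) :
    ψ (dist (T^[n] x) (T^[n] y)) ≤ c ^ n * ψ (dist x y) := by
  induction n with
  | zero => simp
  | succ n ih =>
    rw [Function.iterate_succ_apply', Function.iterate_succ_apply', pow_succ', mul_assoc]
    exact (hT _ _).trans (mul_le_mul_of_nonneg_left ih hc0)

theorem cauchySeq_iterate_of_altering (hψ_nonneg : ∀ t, 0 ≤ t → 0 ≤ ψ t)
    (hψ_zero : ∀ t, 0 ≤ t → (ψ t = 0 ↔ t = 0)) (hψ_cont : ContinuousOn ψ (Set.Ici 0))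
    (hψ_mono : MonotoneOn ψ (Set.Ici 0)) (hc0 : 0 ≤ c) (hc1 : c < 1)
    (hT : ∀ x y : X, ψ (dist (T x) (T y)) ≤ c * ψ (dist x y)) (x : X) :
    CauchySeq fun n => T^[n] x := by
  have hψ_pos {t : ℝ} (ht : 0 < t) : 0 < ψ t := altering_pos hψ_nonneg hψ_zero ht
  refine Metric.cauchySeq_iff'.2 fun r hr => ?_
  obtain ⟨ε, hε, hεr⟩ : ∃ ε > 0, ε + ε < r := ⟨r / 3, by positivity, by linarith⟩
  obtain ⟨δ, hδ, hδε, hlt⟩ := exists_mul_altering_add_lt hψ_cont hc1 hε (hψ_pos hε)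
  have hlim : Filter.Tendsto (fun n : ℕ => c ^ n * ψ (dist x (T x))) Filter.atTop (nhds 0) := by
    simpa using (tendsto_pow_atTop_nhds_zero_of_lt_one hc0 hc1).mul_const (ψ (dist x (T x)))
  obtain ⟨N, hN⟩ := (hlim.eventually_lt_const (hψ_pos hδ)).exists
  have hstep : dist (T^[N] x) (T (T^[N] x)) < δ := by
    rw [← Function.iterate_succ_apply' T, Function.iterate_succ_apply]
    exact lt_of_altering_lt hψ_mono dist_nonneg hδ.le
      ((altering_dist_iterate_le hc0 hT x (T x) N).trans_lt hN)
  -- The closed ball of radius `ε + δ` about the `N`-th iterate is mapped into itself.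
  have hball : ∀ n ≥ N, dist (T^[n] x) (T^[N] x) ≤ ε + δ := by
    intro n hn
    induction n, hn using Nat.le_induction with
    | base => rw [dist_self]; positivity
    | succ n _ ih =>
      rw [Function.iterate_succ_apply']
      have hmap : dist (T (T^[n] x)) (T (T^[N] x)) < ε := by
        refine lt_of_altering_lt hψ_mono dist_nonneg hε.le ((hT _ _).trans_lt ?_)
        exact (mul_le_mul_of_nonneg_left
          (hψ_mono dist_nonneg (add_pos hε hδ).le ih) hc0).trans_lt hlt
      have htri := dist_triangle_right (T (T^[n] x)) (T^[N] x) (T (T^[N] x))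
      linarith
  exact ⟨N, fun n hn => (hball n hn).trans_lt (by linarith)⟩

end AlteringDistance

/-- Khan–Swaleh–Sessa theorem via an altering distance function. -/
theorem khan_altering_distance_fixed_point
    {X : Type*} [MetricSpace X] [CompleteSpace X] [Nonempty X]
    (T : X → X) (ψ : ℝ → ℝ)
    (hψ_nonneg : ∀ t, 0 ≤ t → 0 ≤ ψ t)
    (hψ_zero : ∀ t, 0 ≤ t → (ψ t = 0 ↔ t = 0))
    (hψ_cont : ContinuousOn ψ (Set.Ici 0))
    (hψ_mono : MonotoneOn ψ (Set.Ici 0))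
    (c : ℝ) (hc0 : 0 ≤ c) (hc1 : c < 1)
    (hT : ∀ x y : X, ψ (dist (T x) (T y)) ≤ c * ψ (dist x y)) :
    ∃! x : X, T x = x := by
  obtain ⟨x₀⟩ := ‹Nonempty X›
  obtain ⟨x, hx⟩ := cauchySeq_tendsto_of_complete
    (cauchySeq_iterate_of_altering hψ_nonneg hψ_zero hψ_cont hψ_mono hc0 hc1 hT x₀)
  have hT_cont : Continuous T := (LipschitzWith.of_dist_le_mul (K := 1) fun a b => by
    simpa using dist_map_le_of_altering hψ_nonneg hψ_zero hψ_mono hc1 hT a b).continuous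
  have hfix : T x = x := isFixedPt_of_tendsto_iterate hx hT_cont.continuousAt
  refine ⟨x, hfix, fun y hy => ?_⟩
  by_contra hyx
  have hpos := altering_pos hψ_nonneg hψ_zero (dist_pos.2 hyx)
  have hle := hT y x
  rw [hy, hfix] at hle
  nlinarith
end

section
/- Let (X, d) be a complete metric space and let T : X → X. Suppose there exist two altering distance functions ψ and φ such that ψ(d(Tx, Ty)) ≤ ψ(d(x, y)) − φ(d(x, y)) for all x, y ∈ X. Then T has a unique fixed point. -/
/-- The **Meir–Keeler fixed point theorem**. -/
theorem existsUnique_fixedPoint_of_meirKeeler {X : Type*} [MetricSpace X] [CompleteSpace X]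
    [Nonempty X] {T : X → X}
    (hT : ∀ ε > 0, ∃ δ > 0, ∀ x y, dist x y < ε + δ → dist (T x) (T y) < ε) :
    ∃! x : X, T x = x := by
  have hlt : ∀ x y, x ≠ y → dist (T x) (T y) < dist x y := fun x y hxy => by
    obtain ⟨δ, hδ, h⟩ := hT _ (dist_pos.2 hxy)
    exact h x y (by linarith)
  have hle : ∀ x y, dist (T x) (T y) ≤ dist x y := fun x y => by
    rcases eq_or_ne x y with rfl | hxy
    · simp
    · exact (hlt x y hxy).le
  have hcont : Continuous T := (LipschitzWith.of_dist_le' (K := 1) (by simpa using hle)).continuous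
  obtain ⟨x₀⟩ := ‹Nonempty X›
  let u : ℕ → X := fun n => T^[n] x₀
  have hu : ∀ n, u (n + 1) = T (u n) := fun n => Function.iterate_succ_apply' T n x₀
  have hsmall : ∀ δ > 0, ∃ N, dist (u N) (u (N + 1)) < δ := by
    have hbdd : BddBelow (Set.range fun n => dist (u n) (u (n + 1))) :=
      ⟨0, by rintro _ ⟨n, rfl⟩; exact dist_nonneg⟩
    have hinf : ⨅ n, dist (u n) (u (n + 1)) ≤ 0 := by
      by_contra! hpos
      obtain ⟨δ, hδ, h⟩ := hT _ hpos
      obtain ⟨n, hn⟩ := exists_lt_of_ciInf_lt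
        (lt_add_of_pos_right (⨅ n, dist (u n) (u (n + 1))) hδ)
      have hsucc := h _ _ hn
      rw [← hu, ← hu] at hsucc
      exact hsucc.not_ge (ciInf_le hbdd (n + 1))
    exact fun δ hδ => exists_lt_of_ciInf_lt (hinf.trans_lt hδ)
  have hcauchy : CauchySeq u := by
    refine Metric.cauchySeq_iff'.2 fun ε hε => ?_
    obtain ⟨δ, hδ, h⟩ := hT (ε / 2) (half_pos hε)
    obtain ⟨N, hN⟩ := hsmall (min δ (ε / 2)) (lt_min hδ (half_pos hε))
    have hstay : ∀ k, dist (u N) (u (N + k)) < ε / 2 + min δ (ε / 2) := by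
      intro k
      induction k with
      | zero => simpa using add_pos (half_pos hε) (lt_min hδ (half_pos hε))
      | succ k ih =>
        have hk := h _ _ (ih.trans_le (add_le_add_right (min_le_left δ (ε / 2)) _))
        rw [← hu, ← hu] at hk
        rw [← add_assoc]
        linarith [dist_triangle (u N) (u (N + 1)) (u (N + k + 1))]
    refine ⟨N, fun n hn => ?_⟩
    obtain ⟨k, rfl⟩ := Nat.exists_eq_add_of_le hn
    rw [dist_comm]
    linarith [hstay k, min_le_right δ (ε / 2)]
  obtain ⟨z, hz⟩ := cauchySeq_tendsto_of_complete hcauchy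
  have hfix : T z = z := isFixedPt_of_tendsto_iterate hz hcont.continuousAt
  refine ⟨z, hfix, fun y hy => ?_⟩
  by_contra hne
  simpa [show T y = y from hy, hfix] using hlt y z hne

/-- Dutta–Choudhury fixed point theorem with two altering distance functions. -/
theorem dutta_choudhury_fixed_point
    {X : Type*} [MetricSpace X] [CompleteSpace X] [Nonempty X]
    (T : X → X) (ψ φ : ℝ → ℝ)
    (hψ_nonneg : ∀ t, 0 ≤ t → 0 ≤ ψ t)
    (hψ_zero : ∀ t, 0 ≤ t → (ψ t = 0 ↔ t = 0))
    (hψ_cont : ContinuousOn ψ (Set.Ici 0))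
    (hψ_mono : MonotoneOn ψ (Set.Ici 0))
    (hφ_nonneg : ∀ t, 0 ≤ t → 0 ≤ φ t)
    (hφ_zero : ∀ t, 0 ≤ t → (φ t = 0 ↔ t = 0))
    (hφ_cont : ContinuousOn φ (Set.Ici 0))
    (hφ_mono : MonotoneOn φ (Set.Ici 0))
    (hT : ∀ x y : X, ψ (dist (T x) (T y)) ≤ ψ (dist x y) - φ (dist x y)) :
    ∃! x : X, T x = x := by
  have hφ_pos : ∀ t, 0 < t → 0 < φ t := fun t ht =>
    (hφ_nonneg t ht.le).lt_of_ne fun h => ht.ne' ((hφ_zero t ht.le).1 h.symm)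
  have dist_lt : ∀ (x y : X) (t : ℝ), 0 ≤ t → ψ (dist (T x) (T y)) < ψ t →
      dist (T x) (T y) < t :=
    fun _ _ _ ht h => hψ_mono.reflect_lt dist_nonneg ht h
  refine existsUnique_fixedPoint_of_meirKeeler fun ε hε => ?_
  obtain ⟨δ, hδ, hψδ⟩ := Metric.continuousOn_iff.1 hψ_cont ε hε.le (φ ε) (hφ_pos ε hε)
  refine ⟨δ, hδ, fun x y hxy => ?_⟩
  rcases lt_or_ge (dist x y) ε with hlt | hge
  · rcases eq_or_ne x y with rfl | hne
    · simpa using hε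
    · exact (dist_lt x y _ dist_nonneg
        (by linarith [hT x y, hφ_pos _ (dist_pos.2 hne)])).trans hlt
  · have hclose : ψ (dist x y) - ψ ε < φ ε := by
      refine (le_abs_self _).trans_lt (hψδ _ dist_nonneg ?_)
      rw [Real.dist_eq, abs_of_nonneg] <;> linarith
    exact dist_lt x y ε hε.le (by linarith [hT x y, hφ_mono hε.le dist_nonneg hge])
end

section
/- Let (X, d) be a complete metric space and let T : X → X. Suppose there exists a pair of shifting distance functions (ψ, φ) such that ψ(d(Tx, Ty)) ≤ φ(d(x, y)) for all x, y ∈ X. Then T has a unique fixed point in X. -/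
/-- A pair of shifting distance functions (Berzig). -/
def ShiftingPair (ψ φ : ℝ → ℝ) : Prop :=
  (∀ u v : ℝ, 0 ≤ u → 0 ≤ v → ψ u ≤ φ v → u ≤ v) ∧
  (∀ (u v : ℕ → ℝ) (w : ℝ), (∀ n, 0 ≤ u n) → (∀ n, 0 ≤ v n) →
    Filter.Tendsto u Filter.atTop (nhds w) →
    Filter.Tendsto v Filter.atTop (nhds w) →
    (∀ n, ψ (u n) ≤ φ (v n)) → w = 0)

open Filter Topology

namespace ShiftingPair

variable {X : Type*} [MetricSpace X] {T : X → X} {ψ φ : ℝ → ℝ}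

theorem dist_map_le (hpair : ShiftingPair ψ φ)
    (hT : ∀ x y : X, ψ (dist (T x) (T y)) ≤ φ (dist x y)) (x y : X) :
    dist (T x) (T y) ≤ dist x y :=
  hpair.1 _ _ dist_nonneg dist_nonneg (hT x y)

theorem eq_zero_of_tendsto_dist (hpair : ShiftingPair ψ φ)
    (hT : ∀ x y : X, ψ (dist (T x) (T y)) ≤ φ (dist x y)) {a b : ℕ → X} {w : ℝ}
    (hTab : Tendsto (fun n => dist (T (a n)) (T (b n))) atTop (𝓝 w))
    (hab : Tendsto (fun n => dist (a n) (b n)) atTop (𝓝 w)) : w = 0 :=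
  hpair.2 _ _ w (fun _ => dist_nonneg) (fun _ => dist_nonneg) hTab hab fun _ => hT _ _

theorem antitone_dist_succ (hpair : ShiftingPair ψ φ)
    (hT : ∀ x y : X, ψ (dist (T x) (T y)) ≤ φ (dist x y)) {x : ℕ → X}
    (hx : ∀ n, x (n + 1) = T (x n)) : Antitone fun n => dist (x n) (x (n + 1)) := by
  refine antitone_nat_of_succ_le fun n => ?_
  rw [hx (n + 1), hx n]
  exact hpair.dist_map_le hT _ _

theorem tendsto_dist_succ (hpair : ShiftingPair ψ φ)
    (hT : ∀ x y : X, ψ (dist (T x) (T y)) ≤ φ (dist x y)) {x : ℕ → X}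
    (hx : ∀ n, x (n + 1) = T (x n)) :
    Tendsto (fun n => dist (x n) (x (n + 1))) atTop (𝓝 0) := by
  have hlim := tendsto_atTop_ciInf (hpair.antitone_dist_succ hT hx)
    ⟨0, Set.forall_mem_range.2 fun _ => dist_nonneg⟩
  have hzero := hpair.eq_zero_of_tendsto_dist hT
    (by simpa only [Function.comp_def, ← hx] using hlim.comp (tendsto_add_atTop_nat 1)) hlim
  rwa [hzero] at hlim

theorem cauchySeq (hpair : ShiftingPair ψ φ)
    (hT : ∀ x y : X, ψ (dist (T x) (T y)) ≤ φ (dist x y)) {x : ℕ → X}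
    (hx : ∀ n, x (n + 1) = T (x n)) : CauchySeq x := by
  classical
  have hanti := hpair.antitone_dist_succ hT hx
  have hlim := hpair.tendsto_dist_succ hT hx
  rw [Metric.cauchySeq_iff']
  by_contra! h
  obtain ⟨ε, hε, h⟩ := h
  have key : ∀ N, ∃ m, N ≤ m ∧ ε ≤ dist (x m) (x N) ∧
      dist (x m) (x N) ≤ ε + dist (x N) (x (N + 1)) := by
    intro N
    obtain ⟨hle, hfar⟩ := Nat.find_spec (h N)
    have hmin := fun k => Nat.find_min (h N) (m := k)
    refine ⟨Nat.find (h N), hle, hfar, ?_⟩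
    generalize Nat.find (h N) = m at *
    rcases hle.eq_or_lt with rfl | hlt
    · rw [dist_self] at hfar
      linarith
    · obtain ⟨k, rfl⟩ : ∃ k, m = k + 1 := ⟨m - 1, by omega⟩
      have hk : N ≤ k := by omega
      have hnear : dist (x k) (x N) < ε := by
        by_contra! hge
        exact hmin k (by omega) ⟨hk, hge⟩
      have hstep : dist (x k) (x (k + 1)) ≤ dist (x N) (x (N + 1)) := hanti hk
      have := dist_triangle_left (x (k + 1)) (x N) (x k)
      linarith
  choose m hm hlower hupper using key
  have hdist : Tendsto (fun N => dist (x (m N)) (x N)) atTop (𝓝 ε) :=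
    tendsto_of_tendsto_of_tendsto_of_le_of_le tendsto_const_nhds
      (by simpa using hlim.const_add ε) hlower hupper
  have hdist' : Tendsto (fun N => dist (T (x (m N))) (T (x N))) atTop (𝓝 ε) := by
    refine tendsto_of_tendsto_of_tendsto_of_le_of_le
      (g := fun N => ε - 2 * dist (x N) (x (N + 1)))
      (by simpa using (hlim.const_mul 2).const_sub ε) hdist (fun N => ?_)
      fun N => hpair.dist_map_le hT _ _
    have hstep : dist (x (m N)) (x (m N + 1)) ≤ dist (x N) (x (N + 1)) := hanti (hm N)
    have htri := dist_triangle4_right (x (m N)) (x N) (x (m N + 1)) (x (N + 1))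
    have := hlower N
    simp only [← hx]
    linarith
  exact hε.ne' (hpair.eq_zero_of_tendsto_dist hT hdist' hdist)

end ShiftingPair

/-- Berzig's generalization of the Banach contraction principle via
shifting distance functions. -/
theorem berzig_shifting_fixed_point
    {X : Type*} [MetricSpace X] [CompleteSpace X] [Nonempty X]
    (T : X → X) (ψ φ : ℝ → ℝ) (hpair : ShiftingPair ψ φ)
    (hT : ∀ x y : X, ψ (dist (T x) (T y)) ≤ φ (dist x y)) :
    ∃! x : X, T x = x := by
  obtain ⟨x₀⟩ := ‹Nonempty X›
  have hx : ∀ n, T^[n + 1] x₀ = T (T^[n] x₀) := fun n => Function.iterate_succ_apply' T n x₀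
  obtain ⟨x, hlim⟩ := cauchySeq_tendsto_of_complete
    (hpair.cauchySeq hT (x := fun n => T^[n] x₀) hx)
  have hcont : Continuous T :=
    (LipschitzWith.of_dist_le_mul (K := 1) fun x y => by
      simpa using hpair.dist_map_le hT x y).continuous
  have hfix : T x = x := isFixedPt_of_tendsto_iterate hlim hcont.continuousAt
  refine ⟨x, hfix, fun y hy => dist_eq_zero.1 ?_⟩
  refine hpair.eq_zero_of_tendsto_dist hT (a := fun _ => y) (b := fun _ => x) ?_
    tendsto_const_nhds
  simp only [hfix, show T y = y from hy]
  exact tendsto_const_nhds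
end

section
/- Let (X, d) be a metric space, T : X → X, and (ψ, φ) a pair of shifting distance functions such that ψ(d(Tx, Ty)) ≤ φ(d(x, y)) for all x, y ∈ X. Fix x₀ ∈ X and define the Picard iterates x_{n+1} = T x_n for n ≥ 0. Then d(x_{n+1}, x_n) → 0 as n → ∞. -/
/-- Step 1 (limit): the distances between consecutive Picard iterates tend to 0. -/
theorem berzig_step1_tendsto_zero
    {X : Type*} [MetricSpace X]
    (T : X → X) (ψ φ : ℝ → ℝ) (hpair : ShiftingPair ψ φ)
    (hT : ∀ x y : X, ψ (dist (T x) (T y)) ≤ φ (dist x y))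
    (x₀ : X) (x : ℕ → X) (hx0 : x 0 = x₀) (hx : ∀ n, x (n + 1) = T (x n)) :
    Filter.Tendsto (fun n => dist (x (n + 1)) (x n)) Filter.atTop (nhds 0) := by
  set a : ℕ → ℝ := fun n => dist (x (n + 1)) (x n) with ha
  have hnonneg : ∀ n, 0 ≤ a n := fun n => dist_nonneg
  have hshift : ∀ n, ψ (a (n + 1)) ≤ φ (a n) := fun n => by
    simpa only [ha, ← hx] using hT (x (n + 1)) (x n)
  have hanti : Antitone a :=
    antitone_nat_of_succ_le fun n => hpair.1 _ _ (hnonneg _) (hnonneg _) (hshift n)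
  have hlim : Filter.Tendsto a Filter.atTop (nhds (⨅ n, a n)) :=
    tendsto_atTop_ciInf hanti ⟨0, by rintro _ ⟨n, rfl⟩; exact hnonneg n⟩
  have hzero : ⨅ n, a n = 0 :=
    hpair.2 (fun n => a (n + 1)) a _ (fun n => hnonneg _) hnonneg
      (hlim.comp (Filter.tendsto_add_atTop_nat 1)) hlim hshift
  rwa [hzero] at hlim
end

section
/- Let (X, d) be a metric space, T : X → X, and (ψ, φ) a pair of shifting distance functions such that ψ(d(Tx, Ty)) ≤ φ(d(x, y)) for all x, y ∈ X. Fix x₀ ∈ X and define the Picard iterates x_{n+1} = T x_n for n ≥ 0. Then {x_n} is a Cauchy sequence in X. -/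
open Filter Topology

/-- If consecutive distances tend to zero and the sequence is not Cauchy, then some positive `ε`
is the limit of `dist (x (m n)) (x n)` and of `dist (x (m n + 1)) (x (n + 1))`. -/
lemma exists_tendsto_dist_of_not_cauchySeq {X : Type*} [PseudoMetricSpace X] {x : ℕ → X}
    (hd : Tendsto (fun n => dist (x (n + 1)) (x n)) atTop (𝓝 0)) (hc : ¬ CauchySeq x) :
    ∃ ε > 0, ∃ m : ℕ → ℕ,
      Tendsto (fun n => dist (x (m n)) (x n)) atTop (𝓝 ε) ∧
      Tendsto (fun n => dist (x (m n + 1)) (x (n + 1))) atTop (𝓝 ε) := by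
  rw [Metric.cauchySeq_iff'] at hc
  push Not at hc
  obtain ⟨ε, hε, h⟩ := hc
  have key : ∀ N, ∃ k, N ≤ k ∧ dist (x k) (x N) < ε ∧ ε ≤ dist (x (k + 1)) (x N) := by
    intro N
    by_contra! hN
    obtain ⟨n, hn, hεn⟩ := h N
    refine absurd hεn (not_le.2 ?_)
    induction n, hn using Nat.le_induction with
    | base => simpa using hε
    | succ k hk ih => exact hN k hk (lt_of_not_ge fun hge => absurd (ih hge) (not_lt.2 hge))
  choose k hk hlt hle using key
  have hk_tendsto : Tendsto k atTop atTop := tendsto_atTop_mono hk tendsto_id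
  have hdk := hd.comp hk_tendsto
  have hdk' := hd.comp ((tendsto_add_atTop_nat 1).comp hk_tendsto)
  have hm : Tendsto (fun n => dist (x (k n + 1)) (x n)) atTop (𝓝 ε) := by
    refine tendsto_of_tendsto_of_tendsto_of_le_of_le tendsto_const_nhds
      (by simpa using hdk.const_add ε) hle fun n => ?_
    have := dist_triangle (x (k n + 1)) (x (k n)) (x n)
    have := hlt n
    linarith
  refine ⟨ε, hε, fun n => k n + 1, hm, ?_⟩
  have hdiff : Tendsto (fun n => dist (x (k n + 1 + 1)) (x (n + 1)) - dist (x (k n + 1)) (x n))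
      atTop (𝓝 0) := by
    refine squeeze_zero_norm (fun n => ?_) (by simpa using hdk'.add hd)
    simpa [Real.dist_eq] using
      dist_dist_dist_le (x (k n + 1 + 1)) (x (n + 1)) (x (k n + 1)) (x n)
  simpa using hdiff.add hm

/-- Step 2: the Picard iterates form a Cauchy sequence. -/
theorem berzig_step2_cauchy
    {X : Type*} [MetricSpace X]
    (T : X → X) (ψ φ : ℝ → ℝ) (hpair : ShiftingPair ψ φ)
    (hT : ∀ x y : X, ψ (dist (T x) (T y)) ≤ φ (dist x y))
    (x₀ : X) (x : ℕ → X) (hx0 : x 0 = x₀) (hx : ∀ n, x (n + 1) = T (x n)) :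
    CauchySeq x := by
  obtain ⟨hmono, hlim⟩ := hpair
  have hψφ : ∀ a b, ψ (dist (x (a + 1)) (x (b + 1))) ≤ φ (dist (x a) (x b)) := fun a b => by
    rw [hx a, hx b]
    exact hT _ _
  have hanti : Antitone fun n => dist (x (n + 1)) (x n) :=
    antitone_nat_of_succ_le fun n => hmono _ _ dist_nonneg dist_nonneg (hψφ (n + 1) n)
  have hw := tendsto_atTop_ciInf hanti ⟨0, by rintro _ ⟨n, rfl⟩; exact dist_nonneg⟩
  have hd : Tendsto (fun n => dist (x (n + 1)) (x n)) atTop (𝓝 0) := by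
    rwa [hlim _ _ _ (fun _ => dist_nonneg) (fun _ => dist_nonneg)
      (hw.comp (tendsto_add_atTop_nat 1)) hw fun n => hψφ (n + 1) n] at hw
  by_contra hc
  obtain ⟨ε, hε, m, hv, hu⟩ := exists_tendsto_dist_of_not_cauchySeq hd hc
  exact hε.ne' (hlim _ _ ε (fun _ => dist_nonneg) (fun _ => dist_nonneg) hu hv
    fun n => hψφ (m n) n)
end
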